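/- Uniqueness of the maximal homogeneous partition (completeness part of the proof of Proposition 3): let 𝒞 be a finite multi-resolution cluster set on a finite nonempty set D with layers 𝒞₁, …, 𝒞_{n_c}, and let P be a predicate on subsets of D such that every cluster in the last layer 𝒞_{n_c} satisfies P. Suppose 𝒫 ⊆ 𝒞 is any family such that: (i) the members of 𝒫 are pairwise disjoint and their union is D, and (ii) every member of 𝒫 is a maximal P-cluster of 𝒞. Then 𝒫 equals the collection of all maximal P-clusters of 𝒞; in particular the maximal homogeneous partition is unique. -/

import Mathlib

/-- A multi-resolution cluster set (Definition 2 of the paper) on a finite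
set `D`: a family of clusters organized in layers `0, …, nc − 1`, where each
layer consists of pairwise disjoint clusters covering `D`, and each cluster
of layer `k` (for `k ≥ 1`) is contained in some cluster of layer `k − 1`. -/
structure MRCSet (D : Type*) [DecidableEq D] [Fintype D] where
  /-- number of layers -/
  nc : ℕ
  /-- the clusters of each layer -/
  layer : Fin nc → Finset (Finset D)
  /-- clusters in the same layer are disjoint -/
  layer_disjoint : ∀ k : Fin nc, ∀ C₁ ∈ layer k, ∀ C₂ ∈ layer k,
    C₁ ≠ C₂ → Disjoint C₁ C₂
  /-- every individual belongs to some cluster in each layer -/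
  layer_covers : ∀ k : Fin nc, ∀ i : D, ∃ C ∈ layer k, i ∈ C
  /-- each cluster of layer `k ≥ 1` is contained in a cluster of layer `k − 1` -/
  nested : ∀ k : Fin nc, 1 ≤ (k : ℕ) → ∀ C ∈ layer k,
    ∃ C' ∈ layer ⟨(k : ℕ) - 1, lt_of_le_of_lt (Nat.sub_le _ _) k.isLt⟩, C ⊆ C'

/-- `C` is a cluster of the multi-resolution cluster set `𝒞`. -/
def MRCSet.Mem {D : Type*} [DecidableEq D] [Fintype D]
    (𝒞 : MRCSet D) (C : Finset D) : Prop :=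
  ∃ k : Fin 𝒞.nc, C ∈ 𝒞.layer k

/-- `C` is a maximal `P`-cluster of `𝒞`: it is a cluster of `𝒞` satisfying
`P`, and no cluster of `𝒞` satisfying `P` strictly contains it. -/
def MRCSet.IsMaximal {D : Type*} [DecidableEq D] [Fintype D]
    (𝒞 : MRCSet D) (P : Finset D → Prop) (C : Finset D) : Prop :=
  𝒞.Mem C ∧ P C ∧ ¬ ∃ C' : Finset D, 𝒞.Mem C' ∧ P C' ∧ C ⊂ C'

theorem MRCSet.exists_ancestor {D : Type*} [DecidableEq D] [Fintype D] (𝒞 : MRCSet D)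
    (j : ℕ) (hj : j < 𝒞.nc) (d : ℕ) : ∀ (hk : j + d < 𝒞.nc), ∀ C ∈ 𝒞.layer ⟨j + d, hk⟩,
    ∃ C' ∈ 𝒞.layer ⟨j, hj⟩, C ⊆ C' := by
  induction d with
  | zero => exact fun hk C hC => ⟨C, hC, subset_rfl⟩
  | succ d ih =>
    intro hk C hC
    obtain ⟨C', hC', h⟩ := 𝒞.nested ⟨j + (d + 1), hk⟩ (by simp; omega) C hC
    obtain ⟨C'', hC'', h'⟩ := ih (by omega) C' hC'
    exact ⟨C'', hC'', h.trans h'⟩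

theorem MRCSet.subset_of_le {D : Type*} [DecidableEq D] [Fintype D] (𝒞 : MRCSet D)
    (j k : Fin 𝒞.nc) (hjk : j ≤ k) (A B : Finset D) (hA : A ∈ 𝒞.layer j)
    (hB : B ∈ 𝒞.layer k) (i : D) (hiA : i ∈ A) (hiB : i ∈ B) : B ⊆ A := by
  obtain ⟨j, hj⟩ := j
  obtain ⟨k, hk⟩ := k
  obtain ⟨d, rfl⟩ := Nat.exists_eq_add_of_le (show j ≤ k from hjk)
  obtain ⟨A', hA', h⟩ := 𝒞.exists_ancestor j hj d hk B hB
  by_cases e : A' = A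
  · exact e ▸ h
  · exact absurd hiA (Finset.disjoint_left.mp (𝒞.layer_disjoint _ _ hA' _ hA e) (h hiB))

/-- Uniqueness of the maximal homogeneous partition (completeness part of the
proof of Proposition 3): if every last-layer cluster satisfies `P`, and
`Fam` is a family of maximal `P`-clusters of `𝒞` that are pairwise disjoint
and cover `D`, then `Fam` is exactly the collection of all maximal
`P`-clusters of `𝒞`; in particular the maximal homogeneous partition is
unique. -/
theorem MRCSet.maximal_partition_unique {D : Type*} [DecidableEq D] [Fintype D]
    [Nonempty D] (𝒞 : MRCSet D) (hnc : 0 < 𝒞.nc) (P : Finset D → Prop)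
    (hlast : ∀ C ∈ 𝒞.layer ⟨𝒞.nc - 1, by omega⟩, P C)
    (Fam : Set (Finset D))
    (hdisj : ∀ C₁ ∈ Fam, ∀ C₂ ∈ Fam, C₁ ≠ C₂ → Disjoint C₁ C₂)
    (hcover : ∀ i : D, ∃ C ∈ Fam, i ∈ C)
    (hmax : ∀ C ∈ Fam, 𝒞.IsMaximal P C) :
    Fam = {C : Finset D | 𝒞.IsMaximal P C} := by
  ext C
  refine ⟨hmax C, fun hC => ?_⟩
  obtain ⟨⟨k, hk⟩, hP, hm⟩ := id hC
  rcases C.eq_empty_or_nonempty with rfl | ⟨i, hi⟩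
  · obtain ⟨i⟩ := ‹Nonempty D›
    obtain ⟨F, hF, hiF⟩ := hcover i
    exact absurd ⟨F, (hmax F hF).1, (hmax F hF).2.1, Finset.empty_ssubset.mpr ⟨i, hiF⟩⟩ hm
  · obtain ⟨F, hF, hiF⟩ := hcover i
    obtain ⟨⟨j, hj⟩, hPF, hmF⟩ := hmax F hF
    suffices h : C = F from h ▸ hF
    by_contra hne
    rcases le_total j k with h | h
    · have hs := 𝒞.subset_of_le j k h F C hj hk i hiF hi
      exact hm ⟨F, ⟨j, hj⟩, hPF, hs.ssubset_of_ne hne⟩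
    · have hs := 𝒞.subset_of_le k j h C F hk hj i hi hiF
      exact hmF ⟨C, ⟨k, hk⟩, hP, hs.ssubset_of_ne (Ne.symm hne)⟩
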